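/- Let d ≥ 3. There is a constant c > 0 depending only on d such that for every sufficiently large integer L_0 and every choice of integers (ℓ_k)_{0≤k<K} with |ℓ_k| < K', one has sup_{x ∈ ℤ^d} E_x[ Σ_{I ∈ 𝒮} 1_{H_I < ∞} ] ≤ c · log(L_0/L) · L / log L. -/

import Mathlib

open MeasureTheory Filter

namespace RI

/-- Points of `ℤ^d`. -/
abbrev Zd (d : ℕ) := Fin d → ℤ

/-- `x` and `y` are nearest neighbours: `|x - y| = 1`. -/
def adj {d : ℕ} (x y : Zd d) : Prop := (∑ i, |x i - y i|) = 1

/-- `x` and `y` are `*`-neighbours: `|x - y|_∞ = 1`. -/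
def starAdj {d : ℕ} (x y : Zd d) : Prop := x ≠ y ∧ ∀ i, |x i - y i| ≤ 1

/-- `x` belongs to the plane `ℤ e₁ + ℤ e₂ ⊆ ℤ^d`. -/
def inPlane {d : ℕ} (x : Zd d) : Prop := ∀ i : Fin d, 2 ≤ (i : ℕ) → x i = 0

/-- The `k`-th coordinate of `x`, with value `0` for out-of-range indices. -/
def coord {d : ℕ} (x : Zd d) (k : ℕ) : ℤ := if h : k < d then x ⟨k, h⟩ else 0

/-- `P` is the family of laws of the simple random walks on `ℤ^d` started at the points of
`ℤ^d`: each `P x` is a probability measure on the path space `ℕ → ℤ^d`, and the cylinder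
probabilities are those of the walk with i.i.d. increments uniform on `{± e_i}`. -/
def IsSRW (d : ℕ) (P : Zd d → Measure (ℕ → Zd d)) : Prop :=
  (∀ x, IsProbabilityMeasure (P x)) ∧
  (∀ (x : Zd d) (n : ℕ) (w : ℕ → Zd d),
      (w 0 = x ∧ ∀ k < n, adj (w k) (w (k + 1))) →
        P x {ω | ∀ k ≤ n, ω k = w k} = ((2 * d : ENNReal))⁻¹ ^ n) ∧
  (∀ (x : Zd d) (n : ℕ) (w : ℕ → Zd d),
      ¬(w 0 = x ∧ ∀ k < n, adj (w k) (w (k + 1))) →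
        P x {ω | ∀ k ≤ n, ω k = w k} = 0)

/-- The equilibrium measure of a set `V ⊆ ℤ^d`:
`e_V(x) = P_x[H̃_V = ∞]` for `x ∈ V`, and `0` otherwise. -/
noncomputable def eqm {d : ℕ} (P : Zd d → Measure (ℕ → Zd d)) (V : Set (Zd d)) : Zd d → ℝ :=
  V.indicator fun x => (P x {ω | ∀ n, 1 ≤ n → ω n ∉ V}).toReal

/-- The capacity of a finite set `K ⊆ ℤ^d`. -/
noncomputable def capa {d : ℕ} (P : Zd d → Measure (ℕ → Zd d)) (K : Finset (Zd d)) : ℝ :=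
  ∑ x ∈ K, eqm P (↑K) x

/-- `Q` is a vacant-set law at level `u`: a probability measure on `{0,1}^{ℤ^d}`
(with `true = 1` standing for "vacant") such that
`Q[Y_x = 1 ∀ x ∈ K] = exp(-u cap K)` for every finite `K`. -/
def IsVacantLaw {d : ℕ} (P : Zd d → Measure (ℕ → Zd d)) (u : ℝ)
    (Q : Measure (Zd d → Bool)) : Prop :=
  IsProbabilityMeasure Q ∧
  ∀ K : Finset (Zd d),
    Q {Y | ∀ x ∈ K, Y x = true} = ENNReal.ofReal (Real.exp (-(u * capa P K)))

/-- There is a `*`-path starting in `S`, ending in `T`, all of whose points lie in `A`. -/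
def HasStarPath {d : ℕ} (S T A : Set (Zd d)) : Prop :=
  ∃ (N : ℕ) (w : ℕ → Zd d), w 0 ∈ S ∧ w N ∈ T ∧ (∀ k ≤ N, w k ∈ A) ∧
    ∀ k < N, starAdj (w k) (w (k + 1))

/-- Interior boundary `∂_int U`. -/
def intBdry {d : ℕ} (U : Set (Zd d)) : Set (Zd d) := {x | x ∈ U ∧ ∃ y, y ∉ U ∧ adj x y}

/-- (Exterior) boundary `∂U`. -/
def bdry {d : ℕ} (U : Set (Zd d)) : Set (Zd d) := {x | x ∉ U ∧ ∃ y ∈ U, adj x y}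

/-- `ℓ = 100 ⌊L^{1/100}⌋ + 1`. -/
noncomputable def ellOf (L : ℕ) : ℕ := 100 * ⌊(L : ℝ) ^ ((1 : ℝ) / 100)⌋₊ + 1

/-- The scales `L_{n+1} = ℓ_n L_n`. -/
noncomputable def Lseq (L0 : ℕ) : ℕ → ℕ
  | 0 => L0
  | n + 1 => ellOf (Lseq L0 n) * Lseq L0 n

/-- The levels `u_{n+1} = (1 + 1/log L_n)⁻¹ u_n`. -/
noncomputable def useq (L0 : ℕ) (u0 : ℝ) : ℕ → ℝ
  | 0 => u0
  | n + 1 => (1 + 1 / Real.log (Lseq L0 n))⁻¹ * useq L0 u0 n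

/-- The event (on the configuration space `{0,1}^{ℤ^d}`) that there is a `*`-path from
`[-L,L]² ∩ ℤ²` to `∂_int ([-3L,3L]^d ∩ ℤ^d)` all of whose points lie in `{x ∈ ℤ² : Y_x = 0}`. -/
def qEvent (d : ℕ) (L : ℕ) : Set (Zd d → Bool) :=
  {Y | HasStarPath
    {x : Zd d | inPlane x ∧ ∀ i, |x i| ≤ (L : ℤ)}
    (intBdry {x : Zd d | ∀ i, |x i| ≤ (3 * L : ℤ)})
    {x : Zd d | inPlane x ∧ Y x = false}}


/-- `M = ⌊L₀ exp(-(log L₀)^{1/3})⌋`, so that the smaller scale is `L = 1000 M`. -/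
noncomputable def Mof (L0 : ℕ) : ℕ :=
  ⌊(L0 : ℝ) * Real.exp (-(Real.log L0) ^ ((1 : ℝ) / 3))⌋₊

/-- The smaller length scale `L = 1000 ⌊L₀ exp(-(log L₀)^{1/3})⌋`. -/
noncomputable def Lof (L0 : ℕ) : ℕ := 1000 * Mof L0

/-- `K = ⌊2L₀/L⌋`. -/
noncomputable def Kof (L0 : ℕ) : ℕ := 2 * L0 / Lof L0

/-- `K' = ⌊10⁴ L₀/L⌋`. -/
noncomputable def K'of (L0 : ℕ) : ℕ := 10000 * L0 / Lof L0

/-- The square `C_{k,ℓ} = (kL e₁ + (ℓL/1000) e₂ + [0,L]² × {0}^{d-2}) ∩ ℤ^d`. -/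
noncomputable def CklSet (d : ℕ) (L0 : ℕ) (k : ℕ) (l : ℤ) : Set (Zd d) :=
  {x | inPlane x ∧ (k * Lof L0 : ℤ) ≤ coord x 0 ∧ coord x 0 ≤ (k * Lof L0 : ℤ) + (Lof L0 : ℤ) ∧
       l * (Mof L0 : ℤ) ≤ coord x 1 ∧ coord x 1 ≤ l * (Mof L0 : ℤ) + (Lof L0 : ℤ)}

/-- The vertical segment `I_v = π₁⁻¹(v) ∩ C_{k,ℓ}`. -/
noncomputable def segSet (d : ℕ) (L0 : ℕ) (k : ℕ) (l : ℤ) (v : ℤ) : Set (Zd d) :=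
  {x | x ∈ CklSet d L0 k l ∧ coord x 0 = v}


end RI

namespace RI

/-! ### Nonnegative superharmonic functions bound hitting probabilities -/

lemma adj.exists_single {d : ℕ} {x y : Zd d} (h : adj x y) :
    ∃ i, y = x + Pi.single i 1 ∨ y = x - Pi.single i 1 := by
  unfold adj at h
  have hne : ∃ i, x i - y i ≠ 0 := by
    by_contra! hc
    simp [hc] at h
  obtain ⟨i, hi⟩ := hne
  have hsplit := Finset.add_sum_erase Finset.univ (fun i => |x i - y i|) (Finset.mem_univ i)
  have hi1 : 1 ≤ |x i - y i| := Int.one_le_abs hi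
  have hnn : 0 ≤ ∑ j ∈ Finset.univ.erase i, |x j - y j| :=
    Finset.sum_nonneg fun j _ => abs_nonneg _
  have hrest : ∑ j ∈ Finset.univ.erase i, |x j - y j| = 0 := by
    omega
  have hone : |x i - y i| = 1 := by
    omega
  have hz : ∀ j, j ≠ i → x j = y j := fun j hj => by
    have := (Finset.sum_eq_zero_iff_of_nonneg fun j _ => abs_nonneg (x j - y j)).1 hrest j
      (Finset.mem_erase.2 ⟨hj, Finset.mem_univ j⟩)
    rw [abs_eq_zero] at this
    omega
  refine ⟨i, ?_⟩
  rcases (abs_eq one_pos.le).1 hone with h1 | h1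
  · right
    ext j
    by_cases hj : j = i
    · subst hj
      simp only [Pi.sub_apply, Pi.single_eq_same]
      omega
    · simp [Pi.single_eq_of_ne hj, hz j hj]
  · left
    ext j
    by_cases hj : j = i
    · subst hj
      simp only [Pi.add_apply, Pi.single_eq_same]
      omega
    · simp [Pi.single_eq_of_ne hj, hz j hj]

lemma adj_add_single {d : ℕ} (x : Zd d) (i : Fin d) : adj x (x + Pi.single i 1) := by
  simp [adj, Pi.single_apply, apply_ite]

lemma adj_sub_single {d : ℕ} (x : Zd d) (i : Fin d) : adj x (x - Pi.single i 1) := by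
  simp [adj, Pi.single_apply, apply_ite]

/-- `f` dominates its averages over nearest neighbours. -/
def Superharmonic {d : ℕ} (f : Zd d → ℝ) : Prop :=
  ∀ x, ∑ i, (f (x + Pi.single i 1) + f (x - Pi.single i 1)) ≤ 2 * d * f x

section Hitting

variable {d : ℕ} {P : Zd d → Measure (ℕ → Zd d)} {V : Set (Zd d)} {f : Zd d → ℝ}

/-- The event of following the path `w` up to time `k` and visiting `V` during `[k, k + r]`. -/
def followHit (V : Set (Zd d)) (r k : ℕ) (w : ℕ → Zd d) : Set (ℕ → Zd d) :=
  {ω | (∀ j ≤ k, ω j = w j) ∧ ∃ m, k ≤ m ∧ m ≤ k + r ∧ ω m ∈ V}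

lemma followHit_subset (V : Set (Zd d)) (r k : ℕ) (w : ℕ → Zd d) :
    followHit V r k w ⊆ {ω | ∀ j ≤ k, ω j = w j} := fun _ h => h.1

lemma mem_followHit_update {r k : ℕ} {w ω : ℕ → Zd d} (hw : w k ∉ V)
    (hω : ω ∈ followHit V (r + 1) k w) :
    ω ∈ followHit V r (k + 1) (Function.update w (k + 1) (ω (k + 1))) := by
  obtain ⟨h1, m, hm1, hm2, hm⟩ := hω
  refine ⟨fun j hj => ?_, m, ?_, by omega, hm⟩
  · rcases Nat.lt_or_ge k j with h | h
    · obtain rfl : j = k + 1 := by omega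
      simp
    · rw [Function.update_of_ne (by omega), h1 j h]
  · rcases hm1.eq_or_lt with h | h
    · subst h
      exact absurd (h1 k le_rfl ▸ hm) hw
    · exact h

lemma measure_followHit_le (hd : 0 < d) (hP : IsSRW d P) (hf0 : ∀ x, 0 ≤ f x)
    (hfV : ∀ x ∈ V, 1 ≤ f x) (hf : Superharmonic f) (x : Zd d) (r : ℕ) :
    ∀ (k : ℕ) (w : ℕ → Zd d), (w 0 = x ∧ ∀ j < k, adj (w j) (w (j + 1))) →
      P x (followHit V r k w) ≤ ((2 * d : ENNReal))⁻¹ ^ k * ENNReal.ofReal (f (w k)) := by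
  have hmem : ∀ r k (w : ℕ → Zd d), (w 0 = x ∧ ∀ j < k, adj (w j) (w (j + 1))) → w k ∈ V →
      P x (followHit V r k w) ≤ ((2 * d : ENNReal))⁻¹ ^ k * ENNReal.ofReal (f (w k)) := by
    intro r k w hw hV
    calc P x (followHit V r k w) ≤ ((2 * d : ENNReal))⁻¹ ^ k * 1 := by
          rw [mul_one, ← hP.2.1 x k w hw]
          exact measure_mono (followHit_subset _ _ _ _)
      _ ≤ _ := by
          gcongr
          exact ENNReal.one_le_ofReal.2 (hfV _ hV)
  induction r with
  | zero =>
    intro k w hw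
    by_cases hV : w k ∈ V
    · exact hmem 0 k w hw hV
    · have : followHit V 0 k w = ∅ := by
        rw [Set.eq_empty_iff_forall_notMem]
        rintro ω ⟨h1, m, hm1, hm2, hm⟩
        obtain rfl : m = k := by omega
        exact hV (h1 m le_rfl ▸ hm)
      simp [this]
  | succ r ih =>
    intro k w hw
    by_cases hV : w k ∈ V
    · exact hmem _ k w hw hV
    let E : Zd d → Set (ℕ → Zd d) := fun y => followHit V r (k + 1) (Function.update w (k + 1) y)
    have hpath : ∀ y, adj (w k) y →
        (Function.update w (k + 1) y 0 = x ∧ ∀ j < k + 1,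
          adj (Function.update w (k + 1) y j) (Function.update w (k + 1) y (j + 1))) := by
      intro y hy
      refine ⟨by rw [Function.update_of_ne (by omega), hw.1], fun j hj => ?_⟩
      rw [Function.update_of_ne (by omega)]
      rcases Nat.lt_or_ge j k with h | h
      · rw [Function.update_of_ne (by omega)]
        exact hw.2 j h
      · obtain rfl : j = k := by omega
        simpa using hy
    have hE : ∀ y, adj (w k) y →
        P x (E y) ≤ ((2 * d : ENNReal))⁻¹ ^ (k + 1) * ENNReal.ofReal (f y) := by
      intro y hy
      simpa using ih (k + 1) _ (hpath y hy)
    have hE0 : ∀ y, ¬ adj (w k) y → P x (E y) = 0 := by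
      intro y hy
      refine measure_mono_null (followHit_subset _ _ _ _) (hP.2.2 x (k + 1) _ fun h => hy ?_)
      have := h.2 k (by omega)
      rwa [Function.update_of_ne (by omega), Function.update_self] at this
    have hsub : followHit V (r + 1) k w ⊆
        (⋃ i, E (w k + Pi.single i 1) ∪ E (w k - Pi.single i 1)) ∪
          ⋃ y : {y // ¬ adj (w k) y}, E y := by
      intro ω hω
      have hωE : ω ∈ E (ω (k + 1)) := mem_followHit_update hV hω
      by_cases hy : adj (w k) (ω (k + 1))
      · left
        obtain ⟨i, hi⟩ := hy.exists_single
        refine Set.mem_iUnion.2 ⟨i, ?_⟩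
        rcases hi with hi | hi
        · exact Or.inl (hi ▸ hωE)
        · exact Or.inr (hi ▸ hωE)
      · right
        exact Set.mem_iUnion.2 ⟨⟨_, hy⟩, hωE⟩
    have hnull : P x (⋃ y : {y // ¬ adj (w k) y}, E y) = 0 :=
      measure_iUnion_null fun y => hE0 y y.2
    have hd2 : (2 * d : ENNReal) ≠ 0 := by simp; omega
    have hd2' : (2 * d : ENNReal) ≠ ⊤ := by finiteness
    calc P x (followHit V (r + 1) k w)
        ≤ P x (⋃ i, E (w k + Pi.single i 1) ∪ E (w k - Pi.single i 1)) + 0 := by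
          rw [← hnull]
          exact (measure_mono hsub).trans (measure_union_le _ _)
      _ ≤ ∑ i, (P x (E (w k + Pi.single i 1)) + P x (E (w k - Pi.single i 1))) := by
          rw [add_zero]
          exact (measure_iUnion_fintype_le _ _).trans
            (Finset.sum_le_sum fun i _ => measure_union_le _ _)
      _ ≤ ∑ i, (((2 * d : ENNReal))⁻¹ ^ (k + 1) * ENNReal.ofReal (f (w k + Pi.single i 1)) +
            ((2 * d : ENNReal))⁻¹ ^ (k + 1) * ENNReal.ofReal (f (w k - Pi.single i 1))) := by
          gcongr with i
          · exact hE _ (adj_add_single _ _)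
          · exact hE _ (adj_sub_single _ _)
      _ = ((2 * d : ENNReal))⁻¹ ^ (k + 1) * ENNReal.ofReal
            (∑ i, (f (w k + Pi.single i 1) + f (w k - Pi.single i 1))) := by
          rw [ENNReal.ofReal_sum_of_nonneg fun i _ => add_nonneg (hf0 _) (hf0 _), Finset.mul_sum]
          simp_rw [ENNReal.ofReal_add (hf0 _) (hf0 _), mul_add]
      _ ≤ ((2 * d : ENNReal))⁻¹ ^ (k + 1) * ENNReal.ofReal (2 * d * f (w k)) := by
          gcongr
          exact hf (w k)
      _ = ((2 * d : ENNReal))⁻¹ ^ k * ENNReal.ofReal (f (w k)) := by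
          rw [ENNReal.ofReal_mul (by positivity), ENNReal.ofReal_mul (by positivity), pow_succ,
            mul_assoc, ← mul_assoc (_⁻¹) _ (ENNReal.ofReal (f (w k)))]
          simp only [ENNReal.ofReal_ofNat, ENNReal.ofReal_natCast]
          rw [ENNReal.inv_mul_cancel hd2 hd2', one_mul]

theorem measure_hit_le (hd : 0 < d) (hP : IsSRW d P) (hf0 : ∀ x, 0 ≤ f x)
    (hfV : ∀ x ∈ V, 1 ≤ f x) (hf : Superharmonic f) (x : Zd d) :
    (P x {ω | ∃ m : ℕ, ω m ∈ V}).toReal ≤ f x := by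
  refine ENNReal.toReal_le_of_le_ofReal (hf0 x) ?_
  let S : ℕ → Set (ℕ → Zd d) := fun n => {ω | ∃ m ≤ n, ω m ∈ V}
  have hS : {ω : ℕ → Zd d | ∃ m : ℕ, ω m ∈ V} = ⋃ n, S n := by
    ext ω
    simp only [S, Set.mem_ofPred_eq, Set.mem_iUnion]
    exact ⟨fun ⟨m, hm⟩ => ⟨m, m, le_rfl, hm⟩, fun ⟨_, m, _, hm⟩ => ⟨m, hm⟩⟩
  have hmono : Monotone S := fun a b hab ω ⟨m, hm, h⟩ => ⟨m, hm.trans hab, h⟩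
  rw [hS, hmono.measure_iUnion]
  refine iSup_le fun n => ?_
  have hnull : P x {ω | ω 0 ≠ x} = 0 := by
    have hsub : {ω : ℕ → Zd d | ω 0 ≠ x} ⊆
        ⋃ y : {y : Zd d // y ≠ x}, {ω | ∀ k ≤ 0, ω k = (fun _ => (y : Zd d)) k} := fun ω hω =>
      Set.mem_iUnion.2 ⟨⟨ω 0, hω⟩, fun k hk => by simp [Nat.le_zero.1 hk]⟩
    exact measure_mono_null hsub
      (measure_iUnion_null fun y => hP.2.2 x 0 _ fun h => y.2 h.1)
  have hsub : S n ⊆ followHit V n 0 (fun _ => x) ∪ {ω | ω 0 ≠ x} := by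
    rintro ω ⟨m, hm, h⟩
    by_cases h0 : ω 0 = x
    · exact Or.inl ⟨fun j hj => by simp [Nat.le_zero.1 hj, h0], m, by omega, by omega, h⟩
    · exact Or.inr h0
  calc P x (S n) ≤ P x (followHit V n 0 (fun _ => x)) + 0 := by
        rw [← hnull]
        exact (measure_mono hsub).trans (measure_union_le _ _)
    _ ≤ ENNReal.ofReal (f x) := by
        simpa using measure_followHit_le hd hP hf0 hfV hf x n 0 (fun _ => x) (by simp)

end Hitting

/-! ### An explicit superharmonic function comparable to `1 / |x|` -/

lemma inv_sqrt_one_add_le {t : ℝ} (h1 : -(1 / 4) ≤ t) (h2 : t ≤ 1 / 4) :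
    1 / √(1 + t) ≤ 1 - t / 2 + 3 * t ^ 2 / 8 - 5 * t ^ 3 / 16 + t ^ 4 := by
  set p := 1 - t / 2 + 3 * t ^ 2 / 8 - 5 * t ^ 3 / 16 + t ^ 4 with hp
  have ht2 : t ^ 2 ≤ 1 / 16 := by nlinarith
  have ht3 : -(1 / 64) ≤ t ^ 3 ∧ t ^ 3 ≤ 1 / 64 := by
    constructor <;> nlinarith [sq_nonneg t]
  have ht5 : -(1 / 1024) ≤ t ^ 5 := by nlinarith [sq_nonneg t]
  have ht4 : 0 ≤ t ^ 4 := by positivity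
  have hp0 : 0 ≤ p := by nlinarith [sq_nonneg t]
  have hq : 0 ≤ 93 / 64 + 39 / 32 * t - 99 / 256 * t ^ 2 + 57 / 256 * t ^ 3 + 3 / 8 * t ^ 4
      + t ^ 5 := by linarith [ht3.1]
  have key : 1 ≤ p ^ 2 * (1 + t) := by
    have : p ^ 2 * (1 + t) - 1 = t ^ 4 * (93 / 64 + 39 / 32 * t - 99 / 256 * t ^ 2
        + 57 / 256 * t ^ 3 + 3 / 8 * t ^ 4 + t ^ 5) := by
      rw [hp]; ring
    linarith [mul_nonneg ht4 hq]
  rw [div_le_iff₀ (Real.sqrt_pos.2 (by linarith))]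
  apply le_of_sq_le_sq _ (by positivity)
  rw [one_pow, mul_pow, Real.sq_sqrt (by linarith)]
  exact key

lemma inv_sqrt_add_le {s δ : ℝ} (hs : 0 < s) (h : |δ| ≤ s / 4) :
    1 / √(s + δ) ≤ 1 / √s * (1 - (δ / s) / 2 + 3 * (δ / s) ^ 2 / 8 - 5 * (δ / s) ^ 3 / 16
      + (δ / s) ^ 4) := by
  obtain ⟨h1, h2⟩ := abs_le.1 h
  have : s + δ = s * (1 + δ / s) := by field_simp
  rw [this, Real.sqrt_mul hs.le, ← one_div_mul_one_div]
  gcongr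
  apply inv_sqrt_one_add_le
  · rw [le_div_iff₀ hs]; linarith
  · rw [div_le_iff₀ hs]; linarith

/-- The excess of the mean of the quartic Taylor bound over a pair of opposite neighbours. -/
noncomputable def excess (s x : ℝ) : ℝ :=
  -(1 / s) + 3 / 8 * (2 + 8 * x ^ 2) / s ^ 2 + (2 + 48 * x ^ 2 + 32 * x ^ 4) / s ^ 4

lemma inv_sqrt_pair_le {s x : ℝ} (hx : x ^ 2 + 100 ≤ s) :
    1 / √(s + (1 + 2 * x)) + 1 / √(s + (1 - 2 * x)) ≤ 1 / √s * (2 + excess s x) := by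
  have hs : 0 < s := by nlinarith
  have h1 := inv_sqrt_add_le (δ := 1 + 2 * x) hs (by
    rw [abs_le]; constructor <;> nlinarith [sq_nonneg (x - 4), sq_nonneg (x + 4)])
  have h2 := inv_sqrt_add_le (δ := 1 - 2 * x) hs (by
    rw [abs_le]; constructor <;> nlinarith [sq_nonneg (x - 4), sq_nonneg (x + 4)])
  refine (add_le_add h1 h2).trans ?_
  rw [← mul_add]
  refine mul_le_mul_of_nonneg_left ?_ (by positivity)
  have h3 : 0 ≤ 5 * (2 + 24 * x ^ 2) / s ^ 3 / 16 := by positivity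
  refine le_of_sub_nonneg (h3.trans_eq ?_)
  unfold excess
  field_simp
  ring

lemma excess_add_excess_add_excess_nonpos {s x y z : ℝ} (hs : s = x ^ 2 + y ^ 2 + z ^ 2 + 100) :
    excess s x + excess s y + excess s z ≤ 0 := by
  have hs0 : 100 ≤ s := by nlinarith [sq_nonneg x, sq_nonneg y, sq_nonneg z]
  have hpos : 0 < s := by linarith
  have hq : x ^ 4 + y ^ 4 + z ^ 4 ≤ s ^ 2 := by
    have : 0 ≤ x ^ 2 * y ^ 2 + x ^ 2 * z ^ 2 + y ^ 2 * z ^ 2 := by positivity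
    have : 0 ≤ x ^ 2 + y ^ 2 + z ^ 2 := by positivity
    nlinarith
  have e : excess s x + excess s y + excess s z =
      (-3 * s ^ 3 + 3 / 8 * (6 + 8 * (s - 100)) * s ^ 2 + (6 + 48 * (s - 100)
        + 32 * (x ^ 4 + y ^ 4 + z ^ 4))) / s ^ 4 := by
    have : x ^ 2 = s - 100 - y ^ 2 - z ^ 2 := by linarith
    unfold excess
    rw [this]
    field_simp
    ring
  rw [e]
  apply div_nonpos_of_nonpos_of_nonneg _ (by positivity)
  nlinarith

/-- The function `(x² + y² + z² + 100)^{-1/2}` on `ℤ³`. -/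
noncomputable def pot (x y z : ℤ) : ℝ := 1 / √((x : ℝ) ^ 2 + (y : ℝ) ^ 2 + (z : ℝ) ^ 2 + 100)

lemma pot_nonneg (x y z : ℤ) : 0 ≤ pot x y z := by unfold pot; positivity

lemma pot_comm₁₂ (x y z : ℤ) : pot x y z = pot y x z := by unfold pot; congr 2; ring

lemma pot_comm₁₃ (x y z : ℤ) : pot x y z = pot z y x := by unfold pot; congr 2; ring

lemma pot_pair_le (x y z : ℤ) : pot (x + 1) y z + pot (x - 1) y z ≤
    pot x y z * (2 + excess ((x : ℝ) ^ 2 + (y : ℝ) ^ 2 + (z : ℝ) ^ 2 + 100) x) := by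
  have := inv_sqrt_pair_le (s := (x : ℝ) ^ 2 + (y : ℝ) ^ 2 + (z : ℝ) ^ 2 + 100) (x := x)
    (by nlinarith [sq_nonneg (y : ℝ), sq_nonneg (z : ℝ)])
  unfold pot
  refine le_trans (le_of_eq ?_) this
  push_cast
  congr 3 <;> ring

lemma pot_neighbours_le (x y z : ℤ) :
    (pot (x + 1) y z + pot (x - 1) y z) + (pot x (y + 1) z + pot x (y - 1) z) +
      (pot x y (z + 1) + pot x y (z - 1)) ≤ 6 * pot x y z := by
  have h1 := pot_pair_le x y z
  have h2 := pot_pair_le y x z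
  have h3 := pot_pair_le z y x
  rw [pot_comm₁₂ (y + 1), pot_comm₁₂ (y - 1), pot_comm₁₂ y,
    add_comm ((y : ℝ) ^ 2) ((x : ℝ) ^ 2)] at h2
  rw [pot_comm₁₃ (z + 1), pot_comm₁₃ (z - 1), pot_comm₁₃ z,
    show (z : ℝ) ^ 2 + (y : ℝ) ^ 2 + (x : ℝ) ^ 2 + 100 =
      (x : ℝ) ^ 2 + (y : ℝ) ^ 2 + (z : ℝ) ^ 2 + 100 by ring] at h3
  have h4 := excess_add_excess_add_excess_nonpos
    (rfl : (x : ℝ) ^ 2 + (y : ℝ) ^ 2 + (z : ℝ) ^ 2 + 100 = _)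
  have h5 := mul_nonpos_of_nonneg_of_nonpos (pot_nonneg x y z) h4
  linarith

lemma pot_superharmonic (n : ℕ) (u v : ℤ) :
    Superharmonic fun x : Zd (n + 3) => pot (x 0 - u) (x 1 - v) (x 2) := by
  intro x
  have hmod : 2 % (n + 3) = 2 := Nat.mod_eq_of_lt (by omega)
  have h20 : (2 : Fin (n + 3)) ≠ 0 := by simp [Fin.ext_iff, hmod]
  have h21 : (2 : Fin (n + 3)) ≠ 1 := by simp [Fin.ext_iff, hmod]
  have h10 : (1 : Fin (n + 3)) ≠ 0 := by simp
  have hs (i : Fin n) : i.succ.succ.succ ≠ 0 ∧ i.succ.succ.succ ≠ 1 ∧ i.succ.succ.succ ≠ 2 := by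
    simp [Fin.ext_iff, hmod]
  have e1 : (Fin.succ 0 : Fin (n + 3)) = 1 := rfl
  have e2 : (Fin.succ (Fin.succ 0) : Fin (n + 3)) = 2 := rfl
  rw [Fin.sum_univ_succ, Fin.sum_univ_succ, Fin.sum_univ_succ]
  simp only [Pi.add_apply, Pi.sub_apply, e1, e2, Pi.single_eq_same,
    Pi.single_eq_of_ne h20, Pi.single_eq_of_ne h21, Pi.single_eq_of_ne h10,
    Pi.single_eq_of_ne h20.symm, Pi.single_eq_of_ne h21.symm, Pi.single_eq_of_ne h10.symm,
    Pi.single_eq_of_ne (hs _).1.symm, Pi.single_eq_of_ne (hs _).2.1.symm,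
    Pi.single_eq_of_ne (hs _).2.2.symm, add_zero, sub_zero, Finset.sum_const, Finset.card_univ,
    Fintype.card_fin, nsmul_eq_mul]
  have h := pot_neighbours_le (x 0 - u) (x 1 - v) (x 2)
  rw [show x 0 + 1 - u = x 0 - u + 1 by ring, show x 0 - 1 - u = x 0 - u - 1 by ring,
    show x 1 + 1 - v = x 1 - v + 1 by ring, show x 1 - 1 - v = x 1 - v - 1 by ring]
  push_cast
  linarith

lemma Superharmonic.sum {d : ℕ} {ι : Type*} (s : Finset ι) {f : ι → Zd d → ℝ}
    (h : ∀ i ∈ s, Superharmonic (f i)) : Superharmonic fun x => ∑ i ∈ s, f i x := by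
  intro x
  simp only [← Finset.sum_add_distrib, Finset.mul_sum]
  rw [Finset.sum_comm]
  exact Finset.sum_le_sum fun i hi => h i hi x

lemma Superharmonic.div_const {d : ℕ} {f : Zd d → ℝ} (h : Superharmonic f) {D : ℝ} (hD : 0 ≤ D) :
    Superharmonic fun x => f x / D := by
  intro x
  simp only [← add_div, ← Finset.sum_div, ← mul_div_assoc]
  exact div_le_div_of_nonneg_right (h x) hD

/-! ### Elementary sums -/

lemma sum_range_ite_le_of_antitone {φ : ℕ → ℝ} (hφ : Antitone φ) (h0 : ∀ n, 0 ≤ φ n) (N : ℕ) :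
    ∀ u : ℤ, ∑ v ∈ Finset.range N, (if u ≤ v then φ (u - v).natAbs else 0) ≤
      ∑ n ∈ Finset.range N, φ n := by
  induction N with
  | zero => simp
  | succ N ih =>
    intro u
    rcases le_or_gt u 0 with hu | hu
    · refine Finset.sum_le_sum fun v _ => ?_
      rw [if_pos (by omega)]
      exact hφ (by omega)
    · rw [Finset.sum_range_succ', Finset.sum_range_succ, if_neg (by push_cast; omega), add_zero]
      refine le_add_of_le_of_nonneg (le_trans (le_of_eq ?_) (ih (u - 1))) (h0 N)
      refine Finset.sum_congr rfl fun v _ => ?_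
      push_cast
      rw [show u - 1 - (v : ℤ) = u - (v + 1) by ring]
      simp only [sub_le_iff_le_add]

/-- The values of an antitone function of the distance to a point, summed over an interval. -/
lemma sum_range_natAbs_le_of_antitone {φ : ℕ → ℝ} (hφ : Antitone φ) (h0 : ∀ n, 0 ≤ φ n) (N : ℕ)
    (u : ℤ) : ∑ v ∈ Finset.range N, φ (u - v).natAbs ≤ 2 * ∑ n ∈ Finset.range N, φ n := by
  have h1 := sum_range_ite_le_of_antitone hφ h0 N u
  have h2 := sum_range_ite_le_of_antitone hφ h0 N (N - 1 - u)
  rw [← Finset.sum_range_reflect] at h2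
  have h3 : ∑ v ∈ Finset.range N, φ (u - v).natAbs ≤
      ∑ v ∈ Finset.range N, ((if u ≤ v then φ (u - v).natAbs else 0) +
        (if (N - 1 - u : ℤ) ≤ (N - 1 - v : ℕ) then φ (N - 1 - u - (N - 1 - v : ℕ) : ℤ).natAbs
          else 0)) := by
    refine Finset.sum_le_sum fun v hv => ?_
    rw [Finset.mem_range] at hv
    rcases le_total u v with h | h
    · rw [if_pos h]
      refine le_add_of_nonneg_right ?_
      split_ifs
      · exact h0 _
      · exact le_rfl
    · rw [if_pos (show (N - 1 - u : ℤ) ≤ (N - 1 - v : ℕ) by omega),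
        show (N - 1 - u - (N - 1 - v : ℕ) : ℤ).natAbs = (u - v).natAbs by omega]
      refine le_add_of_nonneg_left ?_
      split_ifs
      · exact h0 _
      · exact le_rfl
  rw [Finset.sum_add_distrib] at h3
  linarith

lemma sum_range_inv_sqrt_le (N : ℕ) :
    ∑ n ∈ Finset.range N, 1 / √((n : ℝ) + 1) ≤ 2 * √(N : ℝ) := by
  induction N with
  | zero => simp
  | succ N ih =>
    rw [Finset.sum_range_succ]
    have h1 : 0 < √((N : ℝ) + 1) := by positivity
    have h2 : 0 ≤ √(N : ℝ) := by positivity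
    have e1 : √((N : ℝ) + 1) ^ 2 = N + 1 := Real.sq_sqrt (by positivity)
    have e2 : √(N : ℝ) ^ 2 = N := Real.sq_sqrt (by positivity)
    have : 1 / √((N : ℝ) + 1) ≤ 2 * (√((N : ℝ) + 1) - √(N : ℝ)) := by
      rw [div_le_iff₀ h1]
      nlinarith [sq_nonneg (√((N : ℝ) + 1) - √(N : ℝ))]
    push_cast
    linarith

lemma sum_Ico_inv_le_log {L N : ℕ} (hL : 0 < L) (hLN : L ≤ N) :
    ∑ n ∈ Finset.Ico L N, 1 / ((n : ℝ) + 1) ≤ Real.log (N / L) := by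
  induction N, hLN using Nat.le_induction with
  | base => simp
  | succ N hN ih =>
    rw [Finset.sum_Ico_succ_top hN]
    have hL' : (0 : ℝ) < L := by exact_mod_cast hL
    have hN' : (0 : ℝ) < N := by exact_mod_cast (hL.trans_le hN)
    have h := Real.log_le_sub_one_of_pos (x := (N : ℝ) / (N + 1)) (by positivity)
    rw [Real.log_div (by positivity) (by positivity)] at *
    have e : (N : ℝ) / (N + 1) - 1 = -(1 / (N + 1)) := by field_simp; ring
    push_cast
    rw [e] at h
    linarith

lemma log_le_sum_range_inv {A : ℝ} (hA : 0 < A) (n : ℕ) :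
    Real.log ((n + A) / A) ≤ ∑ t ∈ Finset.range n, 1 / ((t : ℝ) + A) := by
  induction n with
  | zero => simp [hA.ne']
  | succ n ih =>
    rw [Finset.sum_range_succ]
    have h := Real.log_le_sub_one_of_pos (x := (n + 1 + A) / (n + A)) (by positivity)
    rw [Real.log_div (by positivity) (by positivity)] at *
    have e : (n + 1 + A) / (n + A) - 1 = 1 / (n + A) := by field_simp; ring
    push_cast
    rw [e] at h
    linarith

/-! ### Bounds on sums of the potential -/

lemma natAbs_sq_cast (y : ℤ) : (y : ℝ) ^ 2 = (y.natAbs : ℝ) ^ 2 := by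
  rw [Nat.cast_natAbs, Int.cast_abs, sq_abs]

lemma le_pot_zero (y : ℤ) : 1 / ((y.natAbs : ℝ) + 10) ≤ pot 0 y 0 := by
  unfold pot
  gcongr
  apply Real.sqrt_le_iff.2 ⟨by positivity, ?_⟩
  rw [natAbs_sq_cast y]
  push_cast
  nlinarith [(Nat.cast_nonneg y.natAbs : (0 : ℝ) ≤ _)]

lemma pot_le_inv (x y z : ℤ) : pot x y z ≤ 2 * (1 / ((x.natAbs : ℝ) + 1)) := by
  rw [show 2 * (1 / ((x.natAbs : ℝ) + 1)) = 1 / (((x.natAbs : ℝ) + 1) / 2) by field_simp]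
  unfold pot
  gcongr
  refine Real.le_sqrt_of_sq_le ?_
  rw [natAbs_sq_cast x]
  nlinarith [sq_nonneg (y : ℝ), sq_nonneg (z : ℝ), sq_nonneg ((x.natAbs : ℝ) - 1)]

lemma pot_le_inv_sqrt_mul_inv_sqrt (x y z : ℤ) : pot x y z ≤
    1 / √((x.natAbs : ℝ) + 1) * (1 / √((y.natAbs : ℝ) + 1)) := by
  rw [one_div_mul_one_div, ← Real.sqrt_mul (by positivity)]
  unfold pot
  rw [natAbs_sq_cast x, natAbs_sq_cast y]
  gcongr
  nlinarith [sq_nonneg ((x.natAbs : ℝ) - y.natAbs), sq_nonneg (z : ℝ),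
    sq_nonneg ((x.natAbs : ℝ) - 1), sq_nonneg ((y.natAbs : ℝ) - 1)]

/-- A bound on the potential of a vertical segment of length `L` at horizontal distance `n`. -/
noncomputable def colBound (L n : ℕ) : ℝ :=
  min (4 * √((L : ℝ) + 1) * (1 / √((n : ℝ) + 1))) (2 * ((L : ℝ) + 1) * (1 / ((n : ℝ) + 1)))

lemma colBound_nonneg (L n : ℕ) : 0 ≤ colBound L n := by unfold colBound; positivity

lemma colBound_antitone (L : ℕ) : Antitone (colBound L) := by
  intro m n h
  unfold colBound
  gcongr

lemma sum_pot_le_colBound (L : ℕ) (x y z b : ℤ) :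
    ∑ t ∈ Finset.range (L + 1), pot x (y - (b + t)) z ≤ colBound L x.natAbs := by
  refine le_min ?_ ?_
  · have h1 : Antitone fun n : ℕ => 1 / √((n : ℝ) + 1) := by
      intro m n h
      dsimp only
      gcongr
    have h2 := sum_range_natAbs_le_of_antitone h1 (fun n => by positivity) (L + 1) (y - b)
    have h3 := sum_range_inv_sqrt_le (L + 1)
    calc ∑ t ∈ Finset.range (L + 1), pot x (y - (b + t)) z
        ≤ ∑ t ∈ Finset.range (L + 1), 1 / √((x.natAbs : ℝ) + 1) *
            (1 / √(((y - b - (t : ℤ)).natAbs : ℝ) + 1)) := by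
          refine Finset.sum_le_sum fun t _ => ?_
          rw [← sub_sub]
          exact pot_le_inv_sqrt_mul_inv_sqrt _ _ _
      _ ≤ 1 / √((x.natAbs : ℝ) + 1) * (2 * (2 * √((L : ℝ) + 1))) := by
          rw [← Finset.mul_sum]
          push_cast at h3
          gcongr
          exact h2.trans (by gcongr)
      _ = _ := by ring
  · calc ∑ t ∈ Finset.range (L + 1), pot x (y - (b + t)) z
        ≤ ∑ t ∈ Finset.range (L + 1), 2 * (1 / ((x.natAbs : ℝ) + 1)) :=
          Finset.sum_le_sum fun t _ => pot_le_inv _ _ _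
      _ = _ := by
          simp only [Finset.sum_const, Finset.card_range, nsmul_eq_mul]
          push_cast
          ring

lemma sum_range_colBound_le {L K : ℕ} (hL : 0 < L) (hK : 0 < K) :
    ∑ n ∈ Finset.range (K * L), colBound L n ≤ 16 * L + 4 * L * Real.log K := by
  have hLK : L ≤ K * L := Nat.le_mul_of_pos_left L hK
  have hL' : (1 : ℝ) ≤ L := by exact_mod_cast hL
  have hK' : (1 : ℝ) ≤ K := by exact_mod_cast hK
  rw [← Finset.sum_range_add_sum_Ico _ hLK]
  have h1 : ∑ n ∈ Finset.range L, colBound L n ≤ 16 * L := by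
    calc ∑ n ∈ Finset.range L, colBound L n
        ≤ ∑ n ∈ Finset.range L, 4 * √((L : ℝ) + 1) * (1 / √((n : ℝ) + 1)) :=
          Finset.sum_le_sum fun n _ => min_le_left _ _
      _ ≤ 4 * √((L : ℝ) + 1) * (2 * √(L : ℝ)) := by
          rw [← Finset.mul_sum]
          gcongr
          exact sum_range_inv_sqrt_le L
      _ ≤ 16 * L := by
          have e1 : √((L : ℝ) + 1) ^ 2 = L + 1 := Real.sq_sqrt (by positivity)
          have e2 : √(L : ℝ) ^ 2 = L := Real.sq_sqrt (by positivity)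
          nlinarith [sq_nonneg (√((L : ℝ) + 1) - √(L : ℝ))]
  have h2 : ∑ n ∈ Finset.Ico L (K * L), colBound L n ≤ 4 * L * Real.log K := by
    calc ∑ n ∈ Finset.Ico L (K * L), colBound L n
        ≤ ∑ n ∈ Finset.Ico L (K * L), 2 * ((L : ℝ) + 1) * (1 / ((n : ℝ) + 1)) :=
          Finset.sum_le_sum fun n _ => min_le_right _ _
      _ ≤ 2 * ((L : ℝ) + 1) * Real.log K := by
          rw [← Finset.mul_sum]
          gcongr
          refine (sum_Ico_inv_le_log hL hLK).trans_eq ?_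
          push_cast
          rw [mul_div_cancel_right₀ _ (by positivity)]
      _ ≤ 4 * L * Real.log K := by
          have := Real.log_nonneg hK'
          exact mul_le_mul_of_nonneg_right (by linarith) this
  linarith

lemma log_le_sum_pot {L : ℕ} (hL : 0 < L) {y b : ℤ} (h1 : b ≤ y) (h2 : y ≤ b + L) :
    Real.log (L / 10) ≤ ∑ t ∈ Finset.range (L + 1), pot 0 (y - (b + t)) 0 := by
  obtain ⟨p, hp⟩ := Int.eq_ofNat_of_zero_le (sub_nonneg.2 h1)
  obtain ⟨m, rfl⟩ : ∃ m, L = p + m := Nat.exists_eq_add_of_le (by omega)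
  obtain rfl : y = b + p := by omega
  have hlow : Real.log ((p + 11) / 11) ≤ ∑ t ∈ Finset.range p, pot 0 (b + p - (b + t)) 0 := by
    refine (log_le_sum_range_inv (by norm_num) p).trans ?_
    rw [← Finset.sum_range_reflect]
    refine Finset.sum_le_sum fun t ht => ?_
    rw [Finset.mem_range] at ht
    refine le_trans (le_of_eq ?_) (le_pot_zero _)
    have : (b + p - (b + t) : ℤ).natAbs = p - 1 - t + 1 := by omega
    rw [this]
    push_cast
    congr 1
    ring
  have hhigh : Real.log (((m + 1 : ℕ) + 10) / 10) ≤
      ∑ t ∈ Finset.range (m + 1), pot 0 (b + p - (b + (p + t : ℕ))) 0 := by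
    refine (log_le_sum_range_inv (by norm_num) (m + 1)).trans ?_
    refine Finset.sum_le_sum fun t _ => ?_
    refine le_trans (le_of_eq ?_) (le_pot_zero _)
    have : (b + p - (b + (p + t : ℕ)) : ℤ).natAbs = t := by omega
    rw [this]
  rw [add_assoc p m 1, Finset.sum_range_add]
  refine le_trans ?_ (add_le_add hlow hhigh)
  rw [← Real.log_mul (by positivity) (by positivity)]
  have hL' : (0 : ℝ) < (p + m : ℕ) := by exact_mod_cast hL
  apply Real.log_le_log (by positivity)
  push_cast
  rw [div_mul_div_comm, div_le_div_iff₀ (by norm_num) (by norm_num)]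
  have : (0 : ℝ) ≤ p * m := by positivity
  have hp0 : (0 : ℝ) ≤ p := by positivity
  have hm0 : (0 : ℝ) ≤ m := by positivity
  nlinarith

/-! ### Hitting probabilities of vertical segments -/

lemma measure_hit_segSet_le {d : ℕ} (hd : 3 ≤ d) {L0 : ℕ} (hL : 10 < Lof L0)
    {P : Zd d → Measure (ℕ → Zd d)} (hP : IsSRW d P) (x : Zd d) (k : ℕ) (l v : ℤ) :
    (P x {ω | ∃ m : ℕ, ω m ∈ segSet d L0 k l v}).toReal ≤
      colBound (Lof L0) (coord x 0 - v).natAbs / Real.log (Lof L0 / 10) := by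
  obtain ⟨n, rfl⟩ := Nat.exists_eq_add_of_le' hd
  have c0 (y : Zd (n + 3)) : coord y 0 = y 0 := by simp [coord]
  have c1 (y : Zd (n + 3)) : coord y 1 = y 1 := by simp [coord]
  have hD : 0 < Real.log (Lof L0 / 10) := by
    apply Real.log_pos
    rw [lt_div_iff₀ (by norm_num), one_mul]
    exact_mod_cast hL
  set b : ℤ := l * Mof L0 with hb
  have hmod : 2 % (n + 3) = 2 := Nat.mod_eq_of_lt (by omega)
  refine (measure_hit_le (f := fun y : Zd (n + 3) =>
    (∑ t ∈ Finset.range (Lof L0 + 1), pot (y 0 - v) (y 1 - (b + t)) (y 2)) /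
      Real.log (Lof L0 / 10)) (by omega) hP ?_ ?_ ?_ x).trans ?_
  · exact fun y => div_nonneg (Finset.sum_nonneg fun t _ => pot_nonneg _ _ _) hD.le
  · rintro y ⟨⟨hplane, -, -, h1, h2⟩, h0⟩
    rw [c0] at h0
    rw [c1] at h1 h2
    have hy2 : y 2 = 0 := hplane 2 (by simp [hmod])
    rw [one_le_div hD, h0, sub_self, hy2]
    exact log_le_sum_pot (by omega) h1 h2
  · exact (Superharmonic.sum (Finset.range (Lof L0 + 1)) fun (t : ℕ) _ =>
      pot_superharmonic n v (b + t)).div_const hD.le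
  · rw [c0]
    exact div_le_div_of_nonneg_right (sum_pot_le_colBound _ _ _ _ _) hD.le

lemma sum_range_sum_range_mul {M : Type*} [AddCommMonoid M] (f : ℕ → M) (K L : ℕ) :
    ∑ k ∈ Finset.range K, ∑ j ∈ Finset.range L, f (k * L + j) =
      ∑ v ∈ Finset.range (K * L), f v := by
  induction K with
  | zero => simp
  | succ K ih => rw [Finset.sum_range_succ, ih, Nat.succ_mul, Finset.sum_range_add]

lemma Lof_pos_and_one_le_log {L0 : ℕ} (h : Real.exp 729 ≤ L0) :
    1000 ≤ Lof L0 ∧ 1 ≤ Real.log ((L0 : ℝ) / Lof L0) := by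
  have hL0 : (0 : ℝ) < L0 := (Real.exp_pos _).trans_le h
  have hT : 729 ≤ Real.log L0 := (Real.le_log_iff_exp_le hL0).2 h
  set q := Real.log L0 ^ ((1 : ℝ) / 3) with hq
  have hq3 : q ^ 3 = Real.log L0 := by
    rw [hq, ← Real.rpow_natCast, ← Real.rpow_mul (by linarith)]
    norm_num
  have hq0 : 0 ≤ q := by positivity
  have hq9 : 9 ≤ q := by
    by_contra! hlt
    have : q ^ 3 < 9 ^ 3 := by gcongr
    linarith
  have hexp : (L0 : ℝ) * Real.exp (-q) = Real.exp (q ^ 3 - q) := by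
    rw [sub_eq_add_neg, Real.exp_add, hq3, Real.exp_log hL0]
  have hM : 1 ≤ Mof L0 := by
    unfold Mof
    rw [Nat.one_le_floor_iff, ← hq, hexp]
    exact Real.one_le_exp (by nlinarith [sq_nonneg q])
  have hML : (Mof L0 : ℝ) ≤ L0 * Real.exp (-q) := Nat.floor_le (by positivity)
  have hM' : (1 : ℝ) ≤ Mof L0 := by exact_mod_cast hM
  have hLc : (Lof L0 : ℝ) = 1000 * Mof L0 := by unfold Lof; push_cast; rfl
  refine ⟨by unfold Lof; omega, ?_⟩
  rw [Real.le_log_iff_exp_le (by rw [hLc]; positivity), le_div_iff₀ (by rw [hLc]; positivity), hLc]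
  have h8 : (1000 : ℝ) ≤ Real.exp 8 := by
    have h1 : (2.7 : ℝ) ≤ Real.exp 1 := by linarith [Real.exp_one_gt_d9]
    have h2 : Real.exp 8 = Real.exp 1 ^ 8 := by rw [← Real.exp_nat_mul]; norm_num
    rw [h2]
    calc (1000 : ℝ) ≤ 2.7 ^ 8 := by norm_num
      _ ≤ _ := by gcongr
  calc Real.exp 1 * (1000 * Mof L0)
      ≤ Real.exp 1 * (Real.exp 8 * (L0 * Real.exp (-q))) := by gcongr
    _ = L0 * Real.exp (9 - q) := by
        rw [sub_eq_add_neg, Real.exp_add, show (9 : ℝ) = 1 + 8 by norm_num, Real.exp_add]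
        ring
    _ ≤ L0 * 1 := by
        gcongr
        exact Real.exp_le_one_iff.2 (by linarith)
    _ = L0 := mul_one _

end RI

open RI MeasureTheory Filter

/-- **Expected number of segments of `𝒮` hit by the walk** ((3.14)).
For all sufficiently large `L₀` and any admissible choice of `(ℓ_k)_{0 ≤ k < K}`:
`sup_x E_x[Σ_{I ∈ 𝒮} 1_{H_I < ∞}] ≤ c log(L₀/L) L/log L`. -/
theorem expected_hit_segments (d : ℕ) (hd : 3 ≤ d) :
    ∃ c : ℝ, 0 < c ∧ ∃ c' : ℝ,
      ∀ L0 : ℕ, c' ≤ (L0 : ℝ) →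
        ∀ lk : ℕ → ℤ, (∀ k < Kof L0, |lk k| < (K'of L0 : ℤ)) →
          ∀ (P : Zd d → Measure (ℕ → Zd d)), IsSRW d P →
            ∀ x : Zd d,
              (∑ k ∈ Finset.range (Kof L0), ∑ j ∈ Finset.range (Lof L0),
                  (P x {ω | ∃ m : ℕ,
                    ω m ∈ segSet d L0 k (lk k) (k * Lof L0 + j : ℤ)}).toReal) ≤
                c * Real.log ((L0 : ℝ) / (Lof L0 : ℝ)) * (Lof L0 : ℝ) / Real.log (Lof L0) := by
  refine ⟨96, by norm_num, Real.exp 729, fun L0 hL0 lk _ P hP x => ?_⟩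
  obtain ⟨hL, hlog⟩ := Lof_pos_and_one_le_log hL0
  set L := Lof L0
  set K := Kof L0 with hK
  have hL' : (1000 : ℝ) ≤ L := by exact_mod_cast hL
  have hlogL : 0 < Real.log L := Real.log_pos (by linarith)
  have hD : Real.log L / 2 ≤ Real.log (L / 10) := by
    have h1 : Real.log ((10 : ℝ) ^ 2) ≤ Real.log L := Real.log_le_log (by norm_num) (by linarith)
    rw [Real.log_pow] at h1
    rw [Real.log_div (by positivity) (by norm_num)]
    push_cast at h1
    linarith
  have hD0 : 0 < Real.log (L / 10) := by linarith
  have hsum : ∑ v ∈ Finset.range (K * L), colBound L (coord x 0 - v).natAbs ≤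
      48 * (L * Real.log (L0 / L)) := by
    rcases Nat.eq_zero_or_pos K with h0 | hKpos
    · rw [h0, zero_mul, Finset.range_zero, Finset.sum_empty]
      positivity
    have hK' : (0 : ℝ) < K := by exact_mod_cast hKpos
    have hL0' : (0 : ℝ) < L0 := (Real.exp_pos _).trans_le hL0
    have hlogK : Real.log K ≤ 2 * Real.log (L0 / L) := by
      have hKle : (K : ℝ) ≤ 2 * (L0 / L) := by
        rw [← mul_div_assoc]
        exact_mod_cast (Nat.cast_div_le : ((2 * L0 / L : ℕ) : ℝ) ≤ _)
      have h1 := Real.log_le_log hK' hKle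
      rw [Real.log_mul (by norm_num) (by positivity)] at h1
      linarith [Real.log_two_lt_d9]
    have h1 := sum_range_natAbs_le_of_antitone (colBound_antitone L) (colBound_nonneg L)
      (K * L) (coord x 0)
    have h2 := sum_range_colBound_le (L := L) (by omega) hKpos
    have h3 := mul_le_mul_of_nonneg_left hlogK (show (0 : ℝ) ≤ L by positivity)
    have h4 := mul_le_mul_of_nonneg_left hlog (show (0 : ℝ) ≤ L by positivity)
    linarith
  calc _ ≤ ∑ k ∈ Finset.range K, ∑ j ∈ Finset.range L,
        colBound L (coord x 0 - ((k * L + j : ℕ) : ℤ)).natAbs / Real.log (L / 10) := by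
        refine Finset.sum_le_sum fun k _ => Finset.sum_le_sum fun j _ => ?_
        push_cast
        exact measure_hit_segSet_le hd (by omega) hP x k (lk k) _
    _ = (∑ v ∈ Finset.range (K * L), colBound L (coord x 0 - v).natAbs) / Real.log (L / 10) := by
        rw [sum_range_sum_range_mul
          (fun v => colBound L (coord x 0 - (v : ℤ)).natAbs / Real.log (L / 10)), Finset.sum_div]
    _ ≤ 48 * (L * Real.log (L0 / L)) / (Real.log L / 2) := by gcongr
    _ = 96 * Real.log (L0 / L) * L / Real.log L := by
        field_simp
        ring
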